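/- arXiv:2005.03352 — 13 statements merged into one kernel-verified Lean document; each statement's English description precedes it below -/
import Mathlib

section
/- Suppose the price vector p lies in (0,∞)^n and is a local maximum of the total expected revenue R on ℝ^n. Then for every pair of indices i, k ∈ {1,…,n} one has p_i/(1−r) − 1/β_i = p_k/(1−r) − 1/β_k. -/
/-- Asymptotic market share of product `i` at price vector `p`. -/
noncomputable def marketShare (n : ℕ) (g β : Fin n → ℝ) (r : ℝ) (p : Fin n → ℝ)
    (i : Fin n) : ℝ :=
  Real.exp ((g i - β i * p i) / (1 - r)) /
    (1 + ∑ j, Real.exp ((g j - β j * p j) / (1 - r)))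

/-- Total expected revenue at price vector `p`. -/
noncomputable def totalRevenue (n : ℕ) (g β : Fin n → ℝ) (r : ℝ) (p : Fin n → ℝ) : ℝ :=
  ∑ i, p i * marketShare n g β r p i

/-- At a local maximum of the total revenue, the first-order condition in coordinate `i` expresses
the price of product `i` through the total revenue. -/
theorem price_eq_of_isLocalMax_totalRevenue {n : ℕ} {g β : Fin n → ℝ} {r : ℝ} (hr : r < 1)
    {p : Fin n → ℝ} (hmax : IsLocalMax (totalRevenue n g β r) p) {i : Fin n} (hβ : 0 < β i) :
    p i / (1 - r) - 1 / β i = totalRevenue n g β r p / (1 - r) := by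
  have hs : 0 < 1 - r := sub_pos.mpr hr
  let e : ℝ → ℝ := fun x => Real.exp ((g i - β i * x) / (1 - r))
  let A : ℝ := ∑ j ∈ Finset.univ.erase i, p j * Real.exp ((g j - β j * p j) / (1 - r))
  let B : ℝ := ∑ j ∈ Finset.univ.erase i, Real.exp ((g j - β j * p j) / (1 - r))
  have hB : 0 ≤ B := Finset.sum_nonneg fun j _ => (Real.exp_pos _).le
  have heq : ∀ x, totalRevenue n g β r (Function.update p i x) =
      (x * e x + A) / (1 + (e x + B)) := by
    intro x
    simp only [totalRevenue, marketShare, ← mul_div_assoc]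
    rw [← Finset.sum_div, ← Finset.add_sum_erase _ _ (Finset.mem_univ i),
      ← Finset.add_sum_erase _ _ (Finset.mem_univ i)]
    simp only [Function.update_self, e, A, B]
    congr 2
    · refine Finset.sum_congr rfl fun j hj => ?_
      rw [Function.update_of_ne (Finset.ne_of_mem_erase hj)]
    · congr 1
      refine Finset.sum_congr rfl fun j hj => ?_
      rw [Function.update_of_ne (Finset.ne_of_mem_erase hj)]
  have hcont : ContinuousAt (Function.update p i) (p i) :=
    (continuous_const.update i continuous_id).continuousAt
  have hloc : IsLocalMax (fun x => (x * e x + A) / (1 + (e x + B))) (p i) := by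
    have h : IsLocalMax (totalRevenue n g β r ∘ Function.update p i) (p i) :=
      IsLocalMax.comp_continuous (by rwa [Function.update_eq_self]) hcont
    rwa [show totalRevenue n g β r ∘ Function.update p i = _ from funext heq] at h
  have he : HasDerivAt e (e (p i) * (-(β i * 1) / (1 - r))) (p i) :=
    ((((hasDerivAt_id (p i)).const_mul (β i)).const_sub (g i)).div_const (1 - r)).exp
  have hepos : 0 < e (p i) := Real.exp_pos _
  have hD : 0 < 1 + (e (p i) + B) := by positivity
  have hderiv := hloc.hasDerivAt_eq_zero
    ((((hasDerivAt_id' (p i)).mul he).add_const A).div ((he.add_const B).const_add 1) hD.ne')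
  have hR := heq (p i)
  rw [Function.update_eq_self] at hR
  rw [hR]
  rw [div_eq_zero_iff, or_iff_left (by positivity)] at hderiv
  simp only [Pi.mul_apply] at hderiv
  field_simp at hderiv ⊢
  refine mul_left_cancel₀ hepos.ne' ?_
  linear_combination -hderiv

/-- If a positive price vector is a local maximum of the total expected revenue,
then `p i/(1−r) − 1/β i` is the same for every product `i`. -/
theorem monopolistic_first_order_condition
    (n : ℕ) (hn : 2 ≤ n) (g β : Fin n → ℝ) (hβ : ∀ i, 0 < β i)
    (r : ℝ) (hr0 : 0 < r) (hr1 : r < 1)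
    (p : Fin n → ℝ) (hp : ∀ i, 0 < p i)
    (hmax : IsLocalMax (totalRevenue n g β r) p) :
    ∀ i k : Fin n, p i / (1 - r) - 1 / β i = p k / (1 - r) - 1 / β k := by
  intro i k
  rw [price_eq_of_isLocalMax_totalRevenue hr1 hmax (hβ i),
    price_eq_of_isLocalMax_totalRevenue hr1 hmax (hβ k)]
end

section
/- Assume g i > 0 for all i and let 0 < r₁ < r₂ < 1. Let z₁ > 1 and z₂ > 1 satisfy (z₁ − 1)·exp(z₁) = ∑_{i=1}^n exp(g i/(1−r₁)) and (z₂ − 1)·exp(z₂) = ∑_{i=1}^n exp(g i/(1−r₂)) respectively. Then z₁ < z₂; consequently the no-purchase market share at the monopolistic price, which equals 1/z, is strictly decreasing in the network parameter r: 1/z₁ > 1/z₂. -/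
/-- The normalised monopolistic price is increasing in the network parameter `r`;
consequently the no-purchase market share `1/z` is strictly decreasing in `r`. -/
theorem noPurchase_share_decreasing_in_r
    (n : ℕ) (hn : 2 ≤ n) (g : Fin n → ℝ) (hg : ∀ i, 0 < g i)
    (r₁ r₂ : ℝ) (hr₁ : 0 < r₁) (hr₁₂ : r₁ < r₂) (hr₂ : r₂ < 1)
    (z₁ z₂ : ℝ) (hz₁ : 1 < z₁) (hz₂ : 1 < z₂)
    (he₁ : (z₁ - 1) * Real.exp z₁ = ∑ i, Real.exp (g i / (1 - r₁)))
    (he₂ : (z₂ - 1) * Real.exp z₂ = ∑ i, Real.exp (g i / (1 - r₂))) :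
    z₁ < z₂ ∧ 1 / z₂ < 1 / z₁ := by
  have : Nonempty (Fin n) := ⟨⟨0, by omega⟩⟩
  have hsum : ∑ i, Real.exp (g i / (1 - r₁)) < ∑ i, Real.exp (g i / (1 - r₂)) :=
    Finset.sum_lt_sum_of_nonempty Finset.univ_nonempty fun i _ =>
      Real.exp_lt_exp.2 (div_lt_div_of_pos_left (hg i) (by linarith) (by linarith))
  have hz : z₁ < z₂ := by
    by_contra! h
    have hle : (z₂ - 1) * Real.exp z₂ ≤ (z₁ - 1) * Real.exp z₁ :=
      mul_le_mul (by linarith) (Real.exp_le_exp.2 h) (Real.exp_pos _).le (by linarith)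
    linarith
  exact ⟨hz, one_div_lt_one_div_of_lt (by linarith) hz⟩
end

section
/- Assume g i > 0 for all i, let i₀ be an index with g i₀ ≥ g i for all i (the highest intrinsic utility product), and let 0 < r₁ < r₂ < 1. For k ∈ {1,2} let z_k > 1 satisfy (z_k − 1)·exp(z_k) = ∑_{i=1}^n exp(g i/(1−r_k)), and define φ₁(k) = exp(g i₀/(1−r_k) − z_k) / (1 + exp(−z_k)·∑_{j=1}^n exp(g j/(1−r_k))). Then φ₁(1) < φ₁(2); that is, the market share of the highest intrinsic utility product at the monopolistic price is strictly increasing in the network parameter r. -/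
/-- At a normalised monopolistic price `z`, the market share of a product with exponential
utility `exp a` is its share of the total `S` times the share `(z - 1) / z` of all products. -/
theorem share_eq_of_monopolistic_price {a z S : ℝ} (hz : 1 < z)
    (he : (z - 1) * Real.exp z = S) :
    Real.exp (a - z) / (1 + Real.exp (-z) * S) = (z - 1) / z * (Real.exp a / S) := by
  have hz0 : z ≠ 0 := by linarith
  have hz1 : z - 1 ≠ 0 := by linarith
  have hden : 1 + Real.exp (-z) * S = z := by
    rw [← he, Real.exp_neg]
    field_simp
    ring
  rw [hden, ← he, Real.exp_sub]
  field_simp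

/-- The softmax weight of a maximal entry is monotone in the inverse temperature. -/
theorem softmax_max_monotone {ι : Type*} [Fintype ι] (g : ι → ℝ) (i₀ : ι)
    (hi₀ : ∀ i, g i ≤ g i₀) :
    Monotone fun t : ℝ ↦ Real.exp (g i₀ * t) / ∑ i, Real.exp (g i * t) := by
  intro s t hst
  have hpos (u : ℝ) : 0 < ∑ i, Real.exp (g i * u) :=
    Finset.sum_pos (fun i _ ↦ Real.exp_pos _) ⟨i₀, Finset.mem_univ _⟩
  simp only
  rw [div_le_div_iff₀ (hpos s) (hpos t), Finset.mul_sum, Finset.mul_sum]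
  refine Finset.sum_le_sum fun i _ ↦ ?_
  rw [← Real.exp_add, ← Real.exp_add, Real.exp_le_exp]
  nlinarith [mul_nonneg (sub_nonneg.2 (hi₀ i)) (sub_nonneg.2 hst)]

/-- The market share of the highest intrinsic utility product at the monopolistic price
is strictly increasing in the network parameter `r`. -/
theorem top_product_share_increasing_in_r
    (n : ℕ) (hn : 2 ≤ n) (g : Fin n → ℝ) (hg : ∀ i, 0 < g i)
    (i₀ : Fin n) (hi₀ : ∀ i, g i ≤ g i₀)
    (r₁ r₂ : ℝ) (hr₁ : 0 < r₁) (hr₁₂ : r₁ < r₂) (hr₂ : r₂ < 1)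
    (z₁ z₂ : ℝ) (hz₁ : 1 < z₁) (hz₂ : 1 < z₂)
    (he₁ : (z₁ - 1) * Real.exp z₁ = ∑ i, Real.exp (g i / (1 - r₁)))
    (he₂ : (z₂ - 1) * Real.exp z₂ = ∑ i, Real.exp (g i / (1 - r₂))) :
    Real.exp (g i₀ / (1 - r₁) - z₁) /
        (1 + Real.exp (-z₁) * ∑ j, Real.exp (g j / (1 - r₁)))
      < Real.exp (g i₀ / (1 - r₂) - z₂) /
        (1 + Real.exp (-z₂) * ∑ j, Real.exp (g j / (1 - r₂))) := by
  have ht : (1 - r₁)⁻¹ < (1 - r₂)⁻¹ := inv_strictAnti₀ (by linarith) (by linarith)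
  have hsum : ∑ i, Real.exp (g i / (1 - r₁)) < ∑ i, Real.exp (g i / (1 - r₂)) := by
    refine Finset.sum_lt_sum_of_nonempty ⟨i₀, Finset.mem_univ _⟩ fun i _ ↦ ?_
    rw [Real.exp_lt_exp, div_eq_mul_inv, div_eq_mul_inv]
    exact mul_lt_mul_of_pos_left ht (hg i)
  have hz : z₁ < z₂ := by
    by_contra! h
    rw [← he₁, ← he₂] at hsum
    exact hsum.not_ge (mul_le_mul (by linarith) (Real.exp_le_exp.2 h) (Real.exp_pos _).le
      (by linarith))
  rw [share_eq_of_monopolistic_price hz₁ he₁, share_eq_of_monopolistic_price hz₂ he₂]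
  refine mul_lt_mul ?_ ?_ ?_ (div_nonneg (by linarith) (by linarith))
  · rw [div_lt_div_iff₀ (by linarith) (by linarith)]
    linarith
  · simpa only [div_eq_mul_inv] using softmax_max_monotone g i₀ hi₀ ht.le
  · exact div_pos (Real.exp_pos _)
      (Finset.sum_pos (fun i _ ↦ Real.exp_pos _) ⟨i₀, Finset.mem_univ _⟩)
end

section
/- Assume g i > 0 for all i, and let z : ℝ → ℝ be the function assigning to each r ∈ (0,1) the unique solution z(r) > 1 of (z(r) − 1)·exp(z(r)) = ∑_{i=1}^n exp(g i/(1−r)). Then there exists r* ∈ (0,1) such that the function r ↦ (1−r)·(z(r) − 1) (which equals β times the total expected revenue R(p^M(r)) at the monopolistic price) is strictly increasing on the interval [r*, 1). -/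
/-- Logarithmic form of the power mean inequality for sums of exponentials. -/
lemma mul_log_sum_exp_le {n : ℕ} (hn : 0 < n) (x : Fin n → ℝ) {c : ℝ} (hc : 1 ≤ c) :
    c * Real.log (∑ i, Real.exp (x i)) ≤
      (c - 1) * Real.log n + Real.log (∑ i, Real.exp (c * x i)) := by
  have : Nonempty (Fin n) := ⟨⟨0, hn⟩⟩
  have hpos : ∀ y : Fin n → ℝ, 0 < ∑ i, Real.exp (y i) := fun y =>
    Finset.sum_pos (fun i _ => Real.exp_pos _) Finset.univ_nonempty
  have hnR : (0 : ℝ) < n := by exact_mod_cast hn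
  have h := Real.rpow_sum_le_const_mul_sum_rpow_of_nonneg Finset.univ
    (f := fun i => Real.exp (x i)) hc (fun i _ => (Real.exp_pos _).le)
  simp only [Finset.card_univ, Fintype.card_fin, ← Real.exp_mul, mul_comm _ c] at h
  have hlog := Real.log_le_log (Real.rpow_pos_of_pos (hpos x) c) h
  rwa [Real.log_rpow (hpos x), Real.log_mul (Real.rpow_pos_of_pos hnR _).ne'
    (hpos fun i => c * x i).ne', Real.log_rpow hnR] at hlog

/-- If `log w + w + 1` grows from `w = u` to `w = v` at least as fast as scaling by `c > 1`
allows up to the error `(c - 1) log m` with `m ≤ u`, then `w` itself grows by more than `c`. -/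
lemma mul_lt_of_mul_log_add_le {u v c m : ℝ} (hm : 0 < m) (hu : m ≤ u) (hv : 0 < v)
    (hc : 1 < c)
    (h : c * (Real.log u + u + 1) ≤ (c - 1) * Real.log m + (Real.log v + v + 1)) :
    c * u < v := by
  by_contra! hvu
  have hu0 : 0 < u := hm.trans_le hu
  have hlog : Real.log v ≤ Real.log c + Real.log u := by
    rw [← Real.log_mul (by linarith) hu0.ne']
    exact Real.log_le_log hv hvu
  have hlogc : Real.log c < c - 1 := Real.log_lt_sub_one_of_pos (by linarith) hc.ne'
  have hmu : (c - 1) * Real.log m ≤ (c - 1) * Real.log u :=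
    mul_le_mul_of_nonneg_left (Real.log_le_log hm hu) (by linarith)
  linarith

/-- There exists `r* ∈ (0,1)` such that `r ↦ (1−r)(z(r)−1)` (β times the total expected
revenue at the monopolistic price) is strictly increasing on `[r*, 1)`. -/
theorem monopolistic_revenue_eventually_increasing
    (n : ℕ) (hn : 2 ≤ n) (g : Fin n → ℝ) (hg : ∀ i, 0 < g i)
    (z : ℝ → ℝ)
    (hz : ∀ r ∈ Set.Ioo (0 : ℝ) 1, 1 < z r ∧
        (z r - 1) * Real.exp (z r) = ∑ i, Real.exp (g i / (1 - r))) :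
    ∃ rstar ∈ Set.Ioo (0 : ℝ) 1,
      StrictMonoOn (fun r => (1 - r) * (z r - 1)) (Set.Ico rstar 1) := by
  have hn0 : 0 < n := by omega
  have hnR : (0 : ℝ) < n := by exact_mod_cast hn0
  let j : Fin n := ⟨0, hn0⟩
  obtain ⟨T, hT2, hT⟩ : ∃ T : ℝ, 2 ≤ T ∧ n * Real.exp (n + 1) / g j ≤ T :=
    ⟨max 2 _, le_max_left _ _, le_max_right _ _⟩
  have hT0 : 0 < T := by linarith
  have hTinv : T⁻¹ < 1 := inv_lt_one_of_one_lt₀ (by linarith)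
  have hTinv0 : 0 < T⁻¹ := inv_pos.mpr hT0
  refine ⟨1 - T⁻¹, ⟨by linarith, by linarith⟩, ?_⟩
  have hlog : ∀ r ∈ Set.Ioo (0 : ℝ) 1,
      Real.log (∑ i, Real.exp (g i / (1 - r))) = Real.log (z r - 1) + (z r - 1) + 1 := by
    intro r hr
    obtain ⟨h1, h2⟩ := hz r hr
    rw [← h2, Real.log_mul (by linarith) (Real.exp_pos _).ne', Real.log_exp]
    ring
  rintro a ⟨ha, ha1⟩ b ⟨hb, hb1⟩ hab
  have haI : a ∈ Set.Ioo (0 : ℝ) 1 := ⟨by linarith, ha1⟩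
  have hbI : b ∈ Set.Ioo (0 : ℝ) 1 := ⟨by linarith, hb1⟩
  have ha0 : 0 < 1 - a := by linarith
  have hb0 : 0 < 1 - b := by linarith
  obtain ⟨hza, hzaS⟩ := hz a haI
  have hlarge : (n : ℝ) ≤ z a - 1 := by
    by_contra! hlt
    have hTa : T ≤ (1 - a)⁻¹ := (le_inv_comm₀ hT0 ha0).mpr (by linarith)
    have hsum : Real.exp (g j / (1 - a)) ≤ ∑ i, Real.exp (g i / (1 - a)) :=
      Finset.single_le_sum (f := fun i => Real.exp (g i / (1 - a)))
        (fun i _ => (Real.exp_pos _).le) (Finset.mem_univ j)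
    have hupper : (z a - 1) * Real.exp (z a) ≤ n * Real.exp (n + 1) :=
      mul_le_mul hlt.le (Real.exp_le_exp.mpr (by linarith)) (Real.exp_pos _).le hnR.le
    have hlower : n * Real.exp (n + 1) ≤ g j / (1 - a) := by
      rw [div_le_iff₀ (hg j)] at hT
      rw [div_eq_mul_inv, mul_comm (g j)]
      exact hT.trans (mul_le_mul_of_nonneg_right hTa (hg j).le)
    linarith [Real.add_one_le_exp (g j / (1 - a))]
  have hc : 1 < (1 - a) / (1 - b) := (one_lt_div hb0).mpr (by linarith)
  have hpm := mul_log_sum_exp_le hn0 (fun i => g i / (1 - a)) hc.le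
  have hscale : ∀ i, (1 - a) / (1 - b) * (g i / (1 - a)) = g i / (1 - b) := fun i => by
    field_simp
  simp only [hscale] at hpm
  rw [hlog a haI, hlog b hbI] at hpm
  have hlt := mul_lt_of_mul_log_add_le hnR hlarge (sub_pos.mpr (hz b hbI).1) hc hpm
  rwa [div_mul_eq_mul_div, div_lt_iff₀ hb0, mul_comm (z b - 1)] at hlt
end

section
/- Suppose p ∈ (0,∞)^n satisfies the first-order system β i · p i · (1 − φ*_i(p)) = 1 − r for every i ∈ {1,…,n}. Then p is a pure Nash equilibrium of the price competition game: for every seller i and every alternative price q ≥ 0, one has q · φ*_i(p[i := q]) ≤ p i · φ*_i(p), where p[i := q] is the vector p with its i-th coordinate replaced by q. -/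
/-- Clearing denominators, the best-response inequality under the first-order condition
`b * x * A = A + E` reduces to `1 - t ≤ exp (-t)` with `t = b * (x - q)`. -/
lemma mul_logit_share_le_of_first_order {A E b x q : ℝ} (hA : 0 < A) (hE : 0 < E) (hb : 0 < b)
    (h : b * x * A = A + E) :
    q * (E * Real.exp (b * (x - q)) / (A + E * Real.exp (b * (x - q))))
      ≤ x * (E / (A + E)) := by
  set T := Real.exp (b * (x - q)) with hT
  have hTpos : 0 < T := Real.exp_pos _
  have key : (1 - b * (x - q)) * T ≤ 1 := by
    have h1 := Real.add_one_le_exp (-(b * (x - q)))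
    calc (1 - b * (x - q)) * T ≤ Real.exp (-(b * (x - q))) * T := by
          gcongr
          linarith
      _ = 1 := by rw [hT, ← Real.exp_add]; simp
  have hx : x * (E / (A + E)) = E / (b * A) := by
    rw [← mul_div_assoc, div_eq_div_iff (by positivity) (by positivity)]
    linear_combination E * h
  rw [hx, ← mul_div_assoc, div_le_div_iff₀ (by positivity) (by positivity)]
  have h2 : A * E * ((1 - b * (x - q)) * T) ≤ A * E * 1 := by gcongr
  linear_combination h2 + E * T * h

/-- The market share with the seller's own price separated from the competitors' terms. -/
lemma marketShare_update (n : ℕ) (g β : Fin n → ℝ) (r : ℝ) (p : Fin n → ℝ) (i : Fin n) (q : ℝ) :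
    marketShare n g β r (Function.update p i q) i =
      Real.exp ((g i - β i * q) / (1 - r)) /
        ((1 + ∑ j ∈ Finset.univ.erase i, Real.exp ((g j - β j * p j) / (1 - r))) +
          Real.exp ((g i - β i * q) / (1 - r))) := by
  have hsum : ∑ j ∈ Finset.univ.erase i,
        Real.exp ((g j - β j * Function.update p i q j) / (1 - r)) =
      ∑ j ∈ Finset.univ.erase i, Real.exp ((g j - β j * p j) / (1 - r)) :=
    Finset.sum_congr rfl fun j hj => by
      rw [Function.update_of_ne (Finset.ne_of_mem_erase hj)]
  unfold marketShare
  rw [← Finset.sum_erase_add _ _ (Finset.mem_univ i), hsum, Function.update_self, add_assoc]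

/-- A positive price vector satisfying the first-order system
`βᵢ pᵢ (1 − φ*ᵢ(p)) = 1 − r` is a pure Nash equilibrium of the price competition game. -/
theorem first_order_implies_nash
    (n : ℕ) (hn : 2 ≤ n) (g β : Fin n → ℝ) (hβ : ∀ i, 0 < β i)
    (r : ℝ) (hr0 : 0 < r) (hr1 : r < 1)
    (p : Fin n → ℝ) (hp : ∀ i, 0 < p i)
    (hfoc : ∀ i, β i * p i * (1 - marketShare n g β r p i) = 1 - r) :
    ∀ i : Fin n, ∀ q : ℝ, 0 ≤ q →
      q * marketShare n g β r (Function.update p i q) i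
        ≤ p i * marketShare n g β r p i := by
  intro i q _
  have hs : 0 < 1 - r := sub_pos.mpr hr1
  have hfoci := hfoc i
  have hshare := marketShare_update n g β r p i (p i)
  rw [Function.update_eq_self] at hshare
  rw [hshare] at hfoci ⊢
  rw [marketShare_update]
  set A := 1 + ∑ j ∈ Finset.univ.erase i, Real.exp ((g j - β j * p j) / (1 - r))
  have hA : 0 < A := by positivity
  set E := Real.exp ((g i - β i * p i) / (1 - r)) with hE
  have hEpos : 0 < E := Real.exp_pos _
  have hexp : Real.exp ((g i - β i * q) / (1 - r)) =
      E * Real.exp (β i / (1 - r) * (p i - q)) := by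
    rw [hE, ← Real.exp_add]
    congr 1
    ring
  rw [hexp]
  refine mul_logit_share_le_of_first_order hA hEpos (div_pos (hβ i) hs) ?_
  have hAE : A + E ≠ 0 := by positivity
  rw [one_sub_div hAE, add_sub_cancel_right, ← mul_div_assoc, div_eq_iff hAE] at hfoci
  rw [div_mul_eq_mul_div, div_mul_eq_mul_div, div_eq_iff hs.ne', hfoci, mul_comm]
end

section
/- There exists exactly one price vector p ∈ (0,∞)^n satisfying the system β i · p i · (1 − φ*_i(p)) = 1 − r for all i ∈ {1,…,n}; hence the price competition game has a unique pure Nash equilibrium. -/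
/-- The map `x ↦ x / (1 + |x|)` is strictly increasing on the real line. -/
lemma strictMono_div_one_add_abs : StrictMono fun x : ℝ => x / (1 + |x|) := by
  apply strictMono_of_odd_strictMonoOn_nonneg
  · intro x
    simp [neg_div]
  · intro x hx y hy hxy
    simp only [Set.mem_Ici] at hx hy
    simp only [abs_of_nonneg hx, abs_of_nonneg hy]
    rw [div_lt_div_iff₀ (by linarith) (by linarith)]
    linarith

/-- On the nonnegative half-line, the odds-to-utility map: if `x = w / (1 + w)` is the market share
of a product with odds `w`, then the value at `w` is `x * exp (1 / (1 - x))`.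
It is extended to an odd function on the real line. -/
noncomputable def oddsUtility (w : ℝ) : ℝ := w / (1 + |w|) * Real.exp (1 + |w|)

lemma oddsUtility_neg (w : ℝ) : oddsUtility (-w) = -oddsUtility w := by
  simp [oddsUtility, neg_div]

lemma oddsUtility_strictMono : StrictMono oddsUtility := by
  apply strictMono_of_odd_strictMonoOn_nonneg oddsUtility_neg
  intro x hx y hy hxy
  simp only [Set.mem_Ici] at hx hy
  have h := strictMono_div_one_add_abs hxy
  have hexp : Real.exp (1 + |x|) ≤ Real.exp (1 + |y|) := by
    rw [abs_of_nonneg hx, abs_of_nonneg hy]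
    gcongr
  exact mul_lt_mul h hexp (Real.exp_pos _) (by positivity)

lemma continuous_oddsUtility : Continuous oddsUtility := by
  unfold oddsUtility
  fun_prop (disch := intros; positivity)

lemma le_oddsUtility {w : ℝ} (hw : 0 ≤ w) : w ≤ oddsUtility w := by
  have h1 : 0 < 1 + |w| := by positivity
  have h2 : 1 + |w| ≤ Real.exp (1 + |w|) := by
    linarith [Real.add_one_le_exp (1 + |w|)]
  calc w = w / (1 + |w|) * (1 + |w|) := by field_simp
    _ ≤ oddsUtility w := by unfold oddsUtility; gcongr

lemma oddsUtility_surjective : Function.Surjective oddsUtility := by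
  apply continuous_oddsUtility.surjective
  · refine Filter.tendsto_atTop_mono' _ ?_ Filter.tendsto_id
    filter_upwards [Filter.eventually_ge_atTop 0] with w hw using le_oddsUtility hw
  · refine Filter.tendsto_atBot_mono' _ ?_ Filter.tendsto_id
    filter_upwards [Filter.eventually_le_atBot 0] with w hw
    have h := le_oddsUtility (neg_nonneg.2 hw)
    rw [oddsUtility_neg] at h
    exact neg_le_neg_iff.1 h

/-- The map `oddsUtility` as an order automorphism of the real line. -/
noncomputable def oddsUtilityIso : ℝ ≃o ℝ :=
  oddsUtility_strictMono.orderIsoOfSurjective oddsUtility oddsUtility_surjective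

lemma oddsUtilityIso_apply (w : ℝ) : oddsUtilityIso w = oddsUtility w := rfl

/-- The equilibrium market share of a product with scaled attractiveness `t`. -/
noncomputable def equilibriumShare (t : ℝ) : ℝ :=
  oddsUtilityIso.symm t / (1 + |oddsUtilityIso.symm t|)

lemma strictMono_equilibriumShare : StrictMono equilibriumShare :=
  strictMono_div_one_add_abs.comp oddsUtilityIso.symm.strictMono

lemma continuous_equilibriumShare : Continuous equilibriumShare := by
  have := oddsUtilityIso.symm.continuous
  unfold equilibriumShare
  fun_prop (disch := intros; positivity)

lemma oddsUtilityIso_symm_zero : oddsUtilityIso.symm 0 = 0 := by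
  rw [OrderIso.symm_apply_eq, oddsUtilityIso_apply]
  simp [oddsUtility]

lemma equilibriumShare_zero : equilibriumShare 0 = 0 := by
  simp [equilibriumShare, oddsUtilityIso_symm_zero]

/-- The total market share of all products and the outside option, when the latter has
share `y` and the products have attractiveness `c i`. -/
noncomputable def totalShare {ι : Type*} [Fintype ι] (c : ι → ℝ) (y : ℝ) : ℝ :=
  y + ∑ i, equilibriumShare (c i * y)

lemma strictMono_totalShare {ι : Type*} [Fintype ι] {c : ι → ℝ} (hc : ∀ i, 0 ≤ c i) :
    StrictMono (totalShare c) := by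
  intro x y hxy
  refine add_lt_add_of_lt_of_le hxy (Finset.sum_le_sum fun i _ => ?_)
  exact strictMono_equilibriumShare.monotone (mul_le_mul_of_nonneg_left hxy.le (hc i))

lemma exists_totalShare_eq_one {ι : Type*} [Fintype ι] {c : ι → ℝ} (hc : ∀ i, 0 ≤ c i) :
    ∃ y, 0 < y ∧ totalShare c y = 1 := by
  have hcont : Continuous (totalShare c) := by
    have := continuous_equilibriumShare
    unfold totalShare
    fun_prop
  have h0 : totalShare c 0 = 0 := by simp [totalShare, equilibriumShare_zero]
  have h1 : 1 ≤ totalShare c 1 := by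
    refine le_add_of_nonneg_right (Finset.sum_nonneg fun i _ => ?_)
    rw [← equilibriumShare_zero]
    exact strictMono_equilibriumShare.monotone (by simpa using hc i)
  obtain ⟨y, -, hy⟩ := intermediate_value_Icc zero_le_one hcont.continuousOn
    (show (1 : ℝ) ∈ Set.Icc (totalShare c 0) (totalShare c 1) from ⟨by simp [h0], h1⟩)
  refine ⟨y, (strictMono_totalShare hc).lt_iff_lt.1 ?_, hy⟩
  rw [h0, hy]
  exact one_pos

/-- Any positive solution of the first-order system is determined by the share `y` of the outside
option, which solves `totalShare c y = 1`. -/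
lemma exists_totalShare_eq_one_of_firstOrder {n : ℕ} {g β : Fin n → ℝ} {r : ℝ} (hr1 : r < 1)
    {p : Fin n → ℝ} (hβ : ∀ i, 0 < β i) (hp : ∀ i, 0 < p i)
    (h : ∀ i, β i * p i * (1 - marketShare n g β r p i) = 1 - r) :
    ∃ y, totalShare (fun i => Real.exp (g i / (1 - r))) y = 1 ∧
      ∀ i, p i =
        (1 - r) * (1 + oddsUtilityIso.symm (Real.exp (g i / (1 - r)) * y)) / β i := by
  have hs : 0 < 1 - r := by linarith
  set D : ℝ := 1 + ∑ j, Real.exp ((g j - β j * p j) / (1 - r)) with hD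
  have hDpos : 0 < D := by positivity
  have hshare (i) : marketShare n g β r p i = Real.exp ((g i - β i * p i) / (1 - r)) / D := rfl
  have hw (i) : oddsUtilityIso.symm (Real.exp (g i / (1 - r)) * D⁻¹) =
        β i * p i / (1 - r) - 1 ∧
      equilibriumShare (Real.exp (g i / (1 - r)) * D⁻¹) = marketShare n g β r p i := by
    have hbp : 0 < β i * p i := mul_pos (hβ i) (hp i)
    have hφ : 0 < marketShare n g β r p i := by rw [hshare]; positivity
    have hw0 : 0 ≤ β i * p i / (1 - r) - 1 := by
      rw [sub_nonneg, le_div_iff₀ hs]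
      nlinarith [h i]
    have hx : (β i * p i / (1 - r) - 1) / (1 + |β i * p i / (1 - r) - 1|) =
        marketShare n g β r p i := by
      rw [abs_of_nonneg hw0]
      have := h i
      rw [add_sub_cancel, div_eq_iff (by positivity)]
      field_simp
      linarith
    have hsymm : oddsUtilityIso.symm (Real.exp (g i / (1 - r)) * D⁻¹) =
        β i * p i / (1 - r) - 1 := by
      rw [OrderIso.symm_apply_eq, oddsUtilityIso_apply, oddsUtility, hx, abs_of_nonneg hw0,
        add_sub_cancel, hshare, div_mul_eq_mul_div, ← Real.exp_add, ← add_div, sub_add_cancel]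
      exact div_eq_mul_inv _ _
    exact ⟨hsymm, by rw [equilibriumShare, hsymm, hx]⟩
  refine ⟨D⁻¹, ?_, fun i => ?_⟩
  · simp only [totalShare, (hw _).2, hshare]
    rw [← Finset.sum_div, inv_eq_one_div, ← add_div, ← hD, div_self hDpos.ne']
  · have := hβ i
    rw [(hw i).1]
    field_simp
    ring

/-- A root `y` of `totalShare c y = 1` yields a positive solution of the first-order system. -/
lemma firstOrder_of_totalShare_eq_one {n : ℕ} {g β : Fin n → ℝ} {r : ℝ} (hr1 : r < 1)
    (hβ : ∀ i, 0 < β i) {y : ℝ} (hy : 0 < y)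
    (htotal : totalShare (fun i => Real.exp (g i / (1 - r))) y = 1) {p : Fin n → ℝ}
    (hp : ∀ i, p i =
      (1 - r) * (1 + oddsUtilityIso.symm (Real.exp (g i / (1 - r)) * y)) / β i) :
    (∀ i, 0 < p i) ∧ ∀ i, β i * p i * (1 - marketShare n g β r p i) = 1 - r := by
  have hs : 0 < 1 - r := by linarith
  set w : Fin n → ℝ := fun i => oddsUtilityIso.symm (Real.exp (g i / (1 - r)) * y)
  have hw0 (i) : 0 ≤ w i := by
    rw [← oddsUtilityIso_symm_zero]
    exact oddsUtilityIso.symm.monotone (by positivity)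
  have hbp (i) : β i * p i = (1 - r) * (1 + w i) := by
    rw [hp, mul_div_cancel₀ _ (hβ i).ne']
  have hsh (i) : equilibriumShare (Real.exp (g i / (1 - r)) * y) = w i / (1 + w i) := by
    change w i / (1 + |w i|) = _
    rw [abs_of_nonneg (hw0 i)]
  have hexp (i) : Real.exp ((g i - β i * p i) / (1 - r)) = w i / (1 + w i) / y := by
    have h : w i / (1 + w i) * Real.exp (1 + w i) = Real.exp (g i / (1 - r)) * y := by
      have := oddsUtilityIso.apply_symm_apply (Real.exp (g i / (1 - r)) * y)
      change w i / (1 + |w i|) * Real.exp (1 + |w i|) = _ at this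
      rwa [abs_of_nonneg (hw0 i)] at this
    rw [hbp, sub_div, mul_div_cancel_left₀ _ hs.ne', Real.exp_sub, div_eq_div_iff
      (Real.exp_pos _).ne' hy.ne', h]
  have hφ (i) : marketShare n g β r p i = w i / (1 + w i) := by
    simp only [totalShare, hsh] at htotal
    simp only [marketShare, hexp]
    rw [← Finset.sum_div, one_add_div hy.ne', htotal, div_div_div_cancel_right₀ hy.ne', div_one]
  refine ⟨fun i => ?_, fun i => ?_⟩
  · have := hβ i
    have := hw0 i
    rw [hp]
    change 0 < (1 - r) * (1 + w i) / β i
    positivity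
  · have : 0 < 1 + w i := by linarith [hw0 i]
    rw [hbp, hφ]
    field_simp
    ring

/-- There is exactly one positive price vector satisfying the first-order system
`βᵢ pᵢ (1 − φ*ᵢ(p)) = 1 − r` for all `i`; hence the price competition game has a
unique pure Nash equilibrium. -/
theorem unique_nash_equilibrium
    (n : ℕ) (hn : 2 ≤ n) (g β : Fin n → ℝ) (hβ : ∀ i, 0 < β i)
    (r : ℝ) (hr0 : 0 < r) (hr1 : r < 1) :
    ∃! p : Fin n → ℝ, (∀ i, 0 < p i) ∧
      ∀ i, β i * p i * (1 - marketShare n g β r p i) = 1 - r := by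
  have hc (i) : 0 ≤ Real.exp (g i / (1 - r)) := (Real.exp_pos _).le
  obtain ⟨y, hy, htotal⟩ := exists_totalShare_eq_one hc
  refine ⟨_, firstOrder_of_totalShare_eq_one hr1 hβ hy htotal fun _ => rfl, ?_⟩
  rintro q ⟨hq, hq'⟩
  obtain ⟨z, hz, hqz⟩ := exists_totalShare_eq_one_of_firstOrder hr1 hβ hq hq'
  obtain rfl : z = y := (strictMono_totalShare hc).injective (hz.trans htotal.symm)
  exact funext hqz
end

section
/- Suppose p ∈ (0,∞)^n satisfies β i · p i · (1 − φ*_i(p)) = 1 − r for all i ∈ {1,…,n}. Then β i · p i > 1 − r for every i, and (n−1)/(1−r) < ∑_{i=1}^n 1/(β i · p i) < n/(1−r). -/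
theorem marketShare_pos (n : ℕ) (g β : Fin n → ℝ) (r : ℝ) (p : Fin n → ℝ) (i : Fin n) :
    0 < marketShare n g β r p i := by
  unfold marketShare
  positivity

theorem sum_marketShare_lt_one (n : ℕ) (g β : Fin n → ℝ) (r : ℝ) (p : Fin n → ℝ) :
    ∑ i, marketShare n g β r p i < 1 := by
  unfold marketShare
  rw [← Finset.sum_div, div_lt_one (by positivity)]
  linarith

/-- At the competitive price, each `βᵢ pᵢ` exceeds `1 − r`, and
`(n−1)/(1−r) < ∑ᵢ 1/(βᵢ pᵢ) < n/(1−r)`. -/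
theorem competitive_price_bounds
    (n : ℕ) (hn : 2 ≤ n) (g β : Fin n → ℝ) (hβ : ∀ i, 0 < β i)
    (r : ℝ) (hr0 : 0 < r) (hr1 : r < 1)
    (p : Fin n → ℝ) (hp : ∀ i, 0 < p i)
    (hfoc : ∀ i, β i * p i * (1 - marketShare n g β r p i) = 1 - r) :
    (∀ i, 1 - r < β i * p i) ∧
    ((n : ℝ) - 1) / (1 - r) < ∑ i, 1 / (β i * p i) ∧
    ∑ i, 1 / (β i * p i) < (n : ℝ) / (1 - r) := by
  have hr : 0 < 1 - r := sub_pos.2 hr1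
  have : NeZero n := ⟨by omega⟩
  have hbp : ∀ i, 0 < β i * p i := fun i => mul_pos (hβ i) (hp i)
  have hpos := marketShare_pos n g β r p
  have hlt := sum_marketShare_lt_one n g β r p
  have hsum_pos : 0 < ∑ i, marketShare n g β r p i :=
    Finset.sum_pos (fun i _ => hpos i) Finset.univ_nonempty
  have hinv : ∀ i, 1 / (β i * p i) = (1 - marketShare n g β r p i) / (1 - r) := fun i => by
    rw [div_eq_div_iff (hbp i).ne' hr.ne']
    linarith [hfoc i]
  have hsum : ∑ i, 1 / (β i * p i) = (n - ∑ i, marketShare n g β r p i) / (1 - r) := by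
    simp only [hinv, ← Finset.sum_div, Finset.sum_sub_distrib, Finset.sum_const,
      Finset.card_univ, Fintype.card_fin, nsmul_eq_mul, mul_one]
  refine ⟨fun i => ?_, ?_, ?_⟩
  · linarith [hfoc i, mul_pos (hbp i) (hpos i)]
  · rw [hsum]
    exact div_lt_div_of_pos_right (by linarith) hr
  · rw [hsum]
    exact div_lt_div_of_pos_right (by linarith) hr
end

section
/- Suppose the products are homogeneous: g i = c for all i, where c ∈ ℝ, and let ĉ = exp(c/(1−r)). If p ∈ (0,∞)^n satisfies β i · p i · (1 − φ*_i(p)) = 1 − r for all i, then the normalised prices z i = β i · p i/(1−r) are all equal to a common value z, and z satisfies (z − 1)·exp(z) + (n−1)·ĉ·z = n·ĉ. -/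
/-- The equation `z (1 - a e^{-z}) = 1` with `a ≥ 0` has at most one positive solution. -/
theorem eq_of_mul_one_sub_exp_neg_eq_one {a x y : ℝ} (ha : 0 ≤ a) (hx : 0 < x) (hy : 0 < y)
    (hfx : x * (1 - a * Real.exp (-x)) = 1) (hfy : y * (1 - a * Real.exp (-y)) = 1) :
    x = y := by
  have not_lt : ∀ {u v : ℝ}, 0 < u → u * (1 - a * Real.exp (-u)) = 1 →
      v * (1 - a * Real.exp (-v)) = 1 → ¬ u < v := by
    intro u v hu hfu hfv huv
    have hpos : 0 < 1 - a * Real.exp (-u) :=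
      (mul_pos_iff_of_pos_left hu).mp (hfu.symm ▸ one_pos)
    have hle : a * Real.exp (-v) ≤ a * Real.exp (-u) := by gcongr
    have h₁ : u * (1 - a * Real.exp (-u)) < v * (1 - a * Real.exp (-u)) := by gcongr
    have h₂ : v * (1 - a * Real.exp (-u)) ≤ v * (1 - a * Real.exp (-v)) :=
      mul_le_mul_of_nonneg_left (by linarith) (hu.trans huv).le
    linarith
  exact le_antisymm (le_of_not_gt (not_lt hy hfy hfx)) (le_of_not_gt (not_lt hx hfx hfy))

/-- In the homogeneous case (all intrinsic utilities equal to `c`), the normalised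
competitive prices `zᵢ = βᵢ pᵢ/(1−r)` coincide with a common value `z` satisfying
`(z−1)e^z + (n−1)·ĉ·z = n·ĉ`, where `ĉ = e^{c/(1−r)}`. -/
theorem homogeneous_competition_symmetric
    (n : ℕ) (hn : 2 ≤ n) (g β : Fin n → ℝ) (hβ : ∀ i, 0 < β i)
    (r : ℝ) (hr0 : 0 < r) (hr1 : r < 1)
    (c : ℝ) (hg : ∀ i, g i = c)
    (p : Fin n → ℝ) (hp : ∀ i, 0 < p i)
    (hfoc : ∀ i, β i * p i * (1 - marketShare n g β r p i) = 1 - r) :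
    ∃ z : ℝ, (∀ i, β i * p i / (1 - r) = z) ∧
      (z - 1) * Real.exp z + ((n : ℝ) - 1) * Real.exp (c / (1 - r)) * z
        = (n : ℝ) * Real.exp (c / (1 - r)) := by
  have hr : 0 < 1 - r := sub_pos.mpr hr1
  set C := Real.exp (c / (1 - r)) with hC
  set z : Fin n → ℝ := fun i => β i * p i / (1 - r) with hz
  set S := 1 + ∑ j, C * Real.exp (-z j) with hS
  have hSpos : 0 < S := by positivity
  have hexp : ∀ i, Real.exp ((g i - β i * p i) / (1 - r)) = C * Real.exp (-z i) := by
    intro i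
    rw [hC, ← Real.exp_add, hg i, sub_div, sub_eq_add_neg]
  have hzpos : ∀ i, 0 < z i := fun i => div_pos (mul_pos (hβ i) (hp i)) hr
  have hfix : ∀ i, z i * (1 - C / S * Real.exp (-z i)) = 1 := by
    intro i
    have hshare : marketShare n g β r p i = C / S * Real.exp (-z i) := by
      simp only [marketShare, hexp]
      rw [← hS]
      ring
    rw [← hshare, show z i = β i * p i / (1 - r) from rfl, div_mul_eq_mul_div, hfoc i,
      div_self hr.ne']
  let i₀ : Fin n := ⟨0, by omega⟩
  have heq : ∀ i, z i = z i₀ := fun i =>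
    eq_of_mul_one_sub_exp_neg_eq_one (by positivity) (hzpos i) (hzpos i₀) (hfix i) (hfix i₀)
  refine ⟨z i₀, heq, ?_⟩
  have hSn : S = 1 + n * (C * Real.exp (-z i₀)) := by
    simp [hS, heq]
  have h := hfix i₀
  have hinv : Real.exp (z i₀) * Real.exp (-z i₀) = 1 := by
    rw [← Real.exp_add, add_neg_cancel, Real.exp_zero]
  have hmul : z i₀ * (S - C * Real.exp (-z i₀)) = S := by
    field_simp at h
    linarith
  rw [hSn] at hmul
  linear_combination Real.exp (z i₀) * hmul - (z i₀ * (n - 1) * C - n * C) * hinv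
end

section
/- Assume c > 0 and n ≥ 2, and let 0 < r₁ < r₂ < 1. For k ∈ {1,2} let ĉ_k = exp(c/(1−r_k)) and let z_k > 1 satisfy (z_k − 1)·exp(z_k) + (n−1)·ĉ_k·z_k = n·ĉ_k. Then z_k < n/(n−1) for k = 1, 2, and z₁ < z₂: the normalised competitive price in the homogeneous case is strictly increasing in the network parameter r. -/
/-- A solution `z > 1` of `(z - 1) * exp z + (m - 1) * a * z = m * a` with `a > 0` and `m > 1`
satisfies `z < m / (m - 1)`. -/
theorem lt_div_of_price_equation {m a z : ℝ} (hm : 1 < m) (ha : 0 < a) (hz : 1 < z)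
    (h : (z - 1) * Real.exp z + (m - 1) * a * z = m * a) : z < m / (m - 1) := by
  rw [lt_div_iff₀ (sub_pos.2 hm)]
  have hpos : 0 < (z - 1) * Real.exp z := mul_pos (sub_pos.2 hz) (Real.exp_pos z)
  refine lt_of_mul_lt_mul_left ?_ ha.le
  linarith

/-- The solution `z > 1` of `(z - 1) * exp z + (m - 1) * a * z = m * a` is strictly increasing
in `a > 0`. -/
theorem price_equation_strictMono {m a b z w : ℝ} (hm : 1 < m) (ha : 0 < a) (hab : a < b)
    (hz : 1 < z)
    (hza : (z - 1) * Real.exp z + (m - 1) * a * z = m * a)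
    (hwb : (w - 1) * Real.exp w + (m - 1) * b * w = m * b) : z < w := by
  by_contra! hwz
  have hd : 0 < m - (m - 1) * z := by
    have := (lt_div_iff₀ (sub_pos.2 hm)).1 (lt_div_of_price_equation hm ha hz hza)
    linarith
  have hexp : (w - 1) * Real.exp w ≤ (z - 1) * Real.exp z :=
    mul_le_mul (by linarith) (Real.exp_le_exp.2 hwz) (Real.exp_pos w).le (by linarith)
  have hlt : a * (m - (m - 1) * z) < b * (m - (m - 1) * z) := mul_lt_mul_of_pos_right hab hd
  have hle : b * ((m - 1) * w) ≤ b * ((m - 1) * z) :=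
    mul_le_mul_of_nonneg_left (mul_le_mul_of_nonneg_left hwz (by linarith)) (by linarith)
  linarith

/-- In the homogeneous case, the normalised competitive price satisfies
`z < n/(n−1)` and is strictly increasing in the network parameter `r`. -/
theorem homogeneous_normalised_price_increasing_in_r
    (n : ℕ) (hn : 2 ≤ n) (c : ℝ) (hc : 0 < c)
    (r₁ r₂ : ℝ) (hr₁ : 0 < r₁) (hr₁₂ : r₁ < r₂) (hr₂ : r₂ < 1)
    (z₁ z₂ : ℝ) (hz₁ : 1 < z₁) (hz₂ : 1 < z₂)
    (he₁ : (z₁ - 1) * Real.exp z₁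
        + ((n : ℝ) - 1) * Real.exp (c / (1 - r₁)) * z₁
        = (n : ℝ) * Real.exp (c / (1 - r₁)))
    (he₂ : (z₂ - 1) * Real.exp z₂
        + ((n : ℝ) - 1) * Real.exp (c / (1 - r₂)) * z₂
        = (n : ℝ) * Real.exp (c / (1 - r₂))) :
    z₁ < (n : ℝ) / ((n : ℝ) - 1) ∧ z₂ < (n : ℝ) / ((n : ℝ) - 1) ∧ z₁ < z₂ := by
  have hm : (1 : ℝ) < n := by exact_mod_cast hn
  have hexp : Real.exp (c / (1 - r₁)) < Real.exp (c / (1 - r₂)) :=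
    Real.exp_lt_exp.2 (div_lt_div_of_pos_left hc (by linarith) (by linarith))
  exact ⟨lt_div_of_price_equation hm (Real.exp_pos _) hz₁ he₁,
    lt_div_of_price_equation hm (Real.exp_pos _) hz₂ he₂,
    price_equation_strictMono hm (Real.exp_pos _) hexp hz₁ he₁ he₂⟩
end

section
/- Assume c > 0 and n ≥ 2, and let 0 < r₁ < r₂ < 1. For k ∈ {1,2} let ĉ_k = exp(c/(1−r_k)) and let z_k > 1 satisfy (z_k − 1)·exp(z_k) + (n−1)·ĉ_k·z_k = n·ĉ_k, and define the common equilibrium market share φ_k = ĉ_k / (exp(z_k) + n·ĉ_k). Then φ₁ < φ₂, and consequently the no-purchase market share 1 − n·φ_k satisfies 1 − n·φ₁ > 1 − n·φ₂: in the homogeneous case every product's equilibrium market share is increasing in r and the no-purchase share is decreasing in r. -/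
/-- At a solution of the equilibrium equation the market share equals `1 - 1 / z`. -/
theorem market_share_eq_one_sub_inv {m C z : ℝ} (hm : 0 < m) (hC : 0 < C) (hz : 0 < z)
    (h : (z - 1) * Real.exp z + (m - 1) * C * z = m * C) :
    C / (Real.exp z + m * C) = 1 - 1 / z := by
  have hden : 0 < Real.exp z + m * C := by positivity
  rw [div_eq_iff hden.ne']
  field_simp
  linear_combination -h

/-- The equilibrium price is strictly increasing in the normalised utility `C`. -/
theorem equilibrium_price_lt {m C₁ C₂ z₁ z₂ : ℝ} (hm : 1 ≤ m) (hC₁ : 0 < C₁) (hC : C₁ < C₂)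
    (hz₁ : 1 < z₁)
    (h₁ : (z₁ - 1) * Real.exp z₁ + (m - 1) * C₁ * z₁ = m * C₁)
    (h₂ : (z₂ - 1) * Real.exp z₂ + (m - 1) * C₂ * z₂ = m * C₂) :
    z₁ < z₂ := by
  by_contra! hle
  have hlhs : (z₂ - 1) * Real.exp z₂ ≤ (z₁ - 1) * Real.exp z₁ :=
    mul_le_mul (by linarith) (Real.exp_le_exp.mpr hle) (Real.exp_pos _).le (by linarith)
  have heq : C₁ * (m - (m - 1) * z₁) = (z₁ - 1) * Real.exp z₁ := by linear_combination -h₁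
  have hpos : 0 < m - (m - 1) * z₁ := by
    refine pos_of_mul_pos_right ?_ hC₁.le
    rw [heq]
    exact mul_pos (by linarith) (Real.exp_pos _)
  have hrhs : m - (m - 1) * z₁ ≤ m - (m - 1) * z₂ :=
    sub_le_sub_left (mul_le_mul_of_nonneg_left hle (by linarith)) m
  have hlt : C₁ * (m - (m - 1) * z₁) < C₂ * (m - (m - 1) * z₂) :=
    mul_lt_mul hC hrhs hpos (hC₁.trans hC).le
  linarith

/-- In the homogeneous case, each product's equilibrium market share
`φ = ĉ/(e^z + n·ĉ)` is increasing in `r`, and the no-purchase share `1 − n·φ`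
is decreasing in `r`. -/
theorem homogeneous_market_share_increasing_in_r
    (n : ℕ) (hn : 2 ≤ n) (c : ℝ) (hc : 0 < c)
    (r₁ r₂ : ℝ) (hr₁ : 0 < r₁) (hr₁₂ : r₁ < r₂) (hr₂ : r₂ < 1)
    (z₁ z₂ : ℝ) (hz₁ : 1 < z₁) (hz₂ : 1 < z₂)
    (he₁ : (z₁ - 1) * Real.exp z₁
        + ((n : ℝ) - 1) * Real.exp (c / (1 - r₁)) * z₁
        = (n : ℝ) * Real.exp (c / (1 - r₁)))
    (he₂ : (z₂ - 1) * Real.exp z₂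
        + ((n : ℝ) - 1) * Real.exp (c / (1 - r₂)) * z₂
        = (n : ℝ) * Real.exp (c / (1 - r₂))) :
    Real.exp (c / (1 - r₁)) / (Real.exp z₁ + (n : ℝ) * Real.exp (c / (1 - r₁)))
      < Real.exp (c / (1 - r₂)) / (Real.exp z₂ + (n : ℝ) * Real.exp (c / (1 - r₂)))
    ∧ 1 - (n : ℝ) * (Real.exp (c / (1 - r₂)) /
          (Real.exp z₂ + (n : ℝ) * Real.exp (c / (1 - r₂))))
      < 1 - (n : ℝ) * (Real.exp (c / (1 - r₁)) /
          (Real.exp z₁ + (n : ℝ) * Real.exp (c / (1 - r₁)))) := by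
  have hm : (2 : ℝ) ≤ n := by exact_mod_cast hn
  have hC : Real.exp (c / (1 - r₁)) < Real.exp (c / (1 - r₂)) :=
    Real.exp_lt_exp.mpr (div_lt_div_of_pos_left hc (by linarith) (by linarith))
  have hz : z₁ < z₂ :=
    equilibrium_price_lt (by linarith) (Real.exp_pos _) hC hz₁ he₁ he₂
  rw [market_share_eq_one_sub_inv (by linarith) (Real.exp_pos _) (by linarith) he₁,
    market_share_eq_one_sub_inv (by linarith) (Real.exp_pos _) (by linarith) he₂]
  have hshare : 1 - 1 / z₁ < 1 - 1 / z₂ :=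
    sub_lt_sub_left (one_div_lt_one_div_of_lt (by linarith) hz) 1
  exact ⟨hshare, sub_lt_sub_left (mul_lt_mul_of_pos_left hshare (by linarith)) 1⟩
end

section
/- For every index k ∈ {1,…,n} and every price vector p ∈ ℝ^n, the function q ↦ R(p[k := q]) (the total expected revenue as a function of seller k's price, holding the other prices fixed) is differentiable at q = p_k with derivative φ*_k(p) · [ (β_k/(1−r))·R(p) + 1 − (β_k/(1−r))·p_k ], where p[k := q] denotes p with its k-th coordinate replaced by q. -/
/-- Total expected revenue as a quotient of exponential sums. -/
theorem totalRevenue_eq_div (n : ℕ) (g β : Fin n → ℝ) (r : ℝ) (p : Fin n → ℝ) :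
    totalRevenue n g β r p =
      (∑ i, p i * Real.exp ((g i - β i * p i) / (1 - r))) /
        (1 + ∑ j, Real.exp ((g j - β j * p j) / (1 - r))) := by
  simp only [totalRevenue, marketShare, Finset.sum_div, mul_div_assoc]

/-- If only the `k`-th coordinate varies, a separable sum has the derivative of its `k`-th term. -/
theorem hasDerivAt_sum_update {ι : Type*} [Fintype ι] [DecidableEq ι] (f : ι → ℝ → ℝ)
    (p : ι → ℝ) (k : ι) {f' : ℝ} (hf : HasDerivAt (f k) f' (p k)) :
    HasDerivAt (fun q => ∑ i, f i (Function.update p k q i)) f' (p k) := by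
  have h : (fun q => ∑ i, f i (Function.update p k q i)) =
      fun q => f k q + ∑ i ∈ Finset.univ.erase k, f i (p i) := by
    funext q
    rw [← Finset.add_sum_erase _ _ (Finset.mem_univ k), Function.update_self]
    congr 1
    exact Finset.sum_congr rfl fun i hi => by
      rw [Function.update_of_ne (Finset.ne_of_mem_erase hi)]
  rw [h]
  exact hf.add_const _

/-- The partial derivative of the total expected revenue with respect to seller `k`'s
price equals `φ*ₖ(p)·[(βₖ/(1−r))·R(p) + 1 − (βₖ/(1−r))·pₖ]`. -/
theorem totalRevenue_partial_deriv
    (n : ℕ) (hn : 2 ≤ n) (g β : Fin n → ℝ) (hβ : ∀ i, 0 < β i)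
    (r : ℝ) (hr0 : 0 < r) (hr1 : r < 1)
    (p : Fin n → ℝ) (k : Fin n) :
    HasDerivAt (fun q : ℝ => totalRevenue n g β r (Function.update p k q))
      (marketShare n g β r p k *
        ((β k / (1 - r)) * totalRevenue n g β r p + 1 - (β k / (1 - r)) * p k))
      (p k) := by
  have hexp : HasDerivAt (fun q : ℝ => Real.exp ((g k - β k * q) / (1 - r)))
      (Real.exp ((g k - β k * p k) / (1 - r)) * (-(β k * 1) / (1 - r))) (p k) :=
    ((((hasDerivAt_id' (p k)).const_mul (β k)).const_sub (g k)).div_const (1 - r)).exp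
  have hnum := hasDerivAt_sum_update
    (fun i q => q * Real.exp ((g i - β i * q) / (1 - r))) p k
    ((hasDerivAt_id' (p k)).mul hexp)
  have hden := (hasDerivAt_sum_update
    (fun i q => Real.exp ((g i - β i * q) / (1 - r))) p k hexp).const_add 1
  have hD : 1 + ∑ j, Real.exp ((g j - β j * p j) / (1 - r)) ≠ 0 := by positivity
  have hr : 1 - r ≠ 0 := by linarith
  simp only [totalRevenue_eq_div]
  refine (hnum.div hden (by simpa only [Function.update_eq_self] using hD)).congr_deriv ?_
  simp only [Function.update_eq_self, marketShare]
  field_simp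
  ring
end

section
/- For every index i ∈ {1,…,n} and every price vector p ∈ ℝ^n, the function q ↦ q · φ*_i(p[i := q]) (seller i's expected revenue as a function of his own price, holding the other prices fixed) is differentiable at q = p_i with derivative φ*_i(p) · [ 1 − (β_i · p_i/(1−r)) · (1 − φ*_i(p)) ], where p[i := q] denotes p with its i-th coordinate replaced by q. -/
/-- The derivative of a product's market share with respect to its own price. -/
theorem hasDerivAt_marketShare_update (n : ℕ) (g β : Fin n → ℝ) (r : ℝ)
    (p : Fin n → ℝ) (i : Fin n) :
    HasDerivAt (fun q : ℝ => marketShare n g β r (Function.update p i q) i)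
      (-(β i / (1 - r)) * marketShare n g β r p i * (1 - marketShare n g β r p i)) (p i) := by
  have hexp : HasDerivAt (fun q : ℝ => Real.exp ((g i - β i * q) / (1 - r)))
      (Real.exp ((g i - β i * p i) / (1 - r)) * (-(β i) / (1 - r))) (p i) := by
    simpa using ((((hasDerivAt_id (p i)).const_mul (β i)).const_sub (g i)).div_const (1 - r)).exp
  have hshare (q : ℝ) : marketShare n g β r (Function.update p i q) i =
      Real.exp ((g i - β i * q) / (1 - r)) / (1 + (Real.exp ((g i - β i * q) / (1 - r)) +
        ∑ j ∈ Finset.univ.erase i, Real.exp ((g j - β j * p j) / (1 - r)))) := by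
    unfold marketShare
    rw [← Finset.add_sum_erase _ _ (Finset.mem_univ i), Function.update_self]
    congr 3
    refine Finset.sum_congr rfl fun j hj => ?_
    rw [Function.update_of_ne (Finset.ne_of_mem_erase hj)]
  have hself := hshare (p i)
  rw [Function.update_eq_self] at hself
  simp only [hshare, hself]
  have hpos : 0 < 1 + (Real.exp ((g i - β i * p i) / (1 - r)) +
      ∑ j ∈ Finset.univ.erase i, Real.exp ((g j - β j * p j) / (1 - r))) := by positivity
  refine (hexp.fun_div ((hexp.add_const _).const_add 1) hpos.ne').congr_deriv ?_
  generalize (∑ j ∈ Finset.univ.erase i, Real.exp ((g j - β j * p j) / (1 - r))) = C at *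
  generalize Real.exp ((g i - β i * p i) / (1 - r)) = E at *
  rw [neg_div]
  generalize β i / (1 - r) = b
  field_simp
  ring

/-- The derivative of seller `i`'s expected revenue with respect to his own price equals
`φ*ᵢ(p)·[1 − (βᵢ pᵢ/(1−r))·(1 − φ*ᵢ(p))]`. -/
theorem own_revenue_partial_deriv
    (n : ℕ) (hn : 2 ≤ n) (g β : Fin n → ℝ) (hβ : ∀ i, 0 < β i)
    (r : ℝ) (hr0 : 0 < r) (hr1 : r < 1)
    (p : Fin n → ℝ) (i : Fin n) :
    HasDerivAt (fun q : ℝ => q * marketShare n g β r (Function.update p i q) i)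
      (marketShare n g β r p i *
        (1 - (β i * p i / (1 - r)) * (1 - marketShare n g β r p i)))
      (p i) := by
  refine ((hasDerivAt_id' (p i)).fun_mul (hasDerivAt_marketShare_update n g β r p i)).congr_deriv ?_
  rw [Function.update_eq_self]
  ring
end

section
/- Let g : Fin n → ℝ and let z : ℝ → ℝ be differentiable on (0,1) and satisfy (z(r) − 1)·exp(z(r)) = ∑_{i=1}^n exp(g i/(1−r)) for every r ∈ (0,1), with z(r) > 1. Then for every r ∈ (0,1), the derivative of z at r equals (1/(1−r)²) · ∑_{i=1}^n g_i · φ_i(r), where φ_i(r) = exp(g i/(1−r) − z(r)) / (1 + exp(−z(r))·∑_{j=1}^n exp(g j/(1−r))). -/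
/-- Implicit differentiation of the normalised monopolistic price: if `z(r)` solves
`(z(r)−1)e^{z(r)} = ∑ᵢ e^{gᵢ/(1−r)}` on `(0,1)`, then
`z'(r) = (1/(1−r)²)·∑ᵢ gᵢ·φᵢ(r)` where `φᵢ(r)` is product `i`'s market share at the
monopolistic price. -/
theorem normalised_price_deriv
    (n : ℕ) (hn : 2 ≤ n) (g : Fin n → ℝ)
    (z : ℝ → ℝ)
    (hdiff : ∀ r ∈ Set.Ioo (0 : ℝ) 1, DifferentiableAt ℝ z r)
    (hz : ∀ r ∈ Set.Ioo (0 : ℝ) 1, 1 < z r ∧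
        (z r - 1) * Real.exp (z r) = ∑ i, Real.exp (g i / (1 - r))) :
    ∀ r ∈ Set.Ioo (0 : ℝ) 1,
      deriv z r = (1 / (1 - r) ^ 2) *
        ∑ i, g i * (Real.exp (g i / (1 - r) - z r) /
          (1 + Real.exp (-(z r)) * ∑ j, Real.exp (g j / (1 - r)))) := by
  intro r hr
  obtain ⟨hz1, hzr⟩ := hz r hr
  have hr1 : 1 - r ≠ 0 := by linarith [hr.2]
  have hz0 : z r ≠ 0 := by linarith
  have hd := (hdiff r hr).hasDerivAt
  have hL : HasDerivAt (fun s => (z s - 1) * Real.exp (z s))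
      (deriv z r * Real.exp (z r) + (z r - 1) * (Real.exp (z r) * deriv z r)) r :=
    (hd.sub_const 1).mul hd.exp
  have hR : HasDerivAt (fun s => ∑ i, Real.exp (g i / (1 - s)))
      (∑ i, Real.exp (g i / (1 - r)) * (g i / (1 - r) ^ 2)) r := by
    refine HasDerivAt.fun_sum fun i _ => HasDerivAt.exp ?_
    have h := (hasDerivAt_const r (g i)).fun_div ((hasDerivAt_id' r).const_sub 1) hr1
    exact h.congr_deriv (by ring)
  have heq : (fun s => (z s - 1) * Real.exp (z s)) =ᶠ[nhds r]
      fun s => ∑ i, Real.exp (g i / (1 - s)) := by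
    filter_upwards [isOpen_Ioo.mem_nhds hr] with s hs using (hz s hs).2
  have hderiv := hL.unique (hR.congr_of_eventuallyEq heq)
  have hden : 1 + Real.exp (-(z r)) * ∑ j, Real.exp (g j / (1 - r)) = z r := by
    rw [← hzr, Real.exp_neg]
    field_simp
    ring
  have hprod : deriv z r * (z r * Real.exp (z r)) =
      ∑ i, Real.exp (g i / (1 - r)) * (g i / (1 - r) ^ 2) := by
    rw [← hderiv]
    ring
  rw [hden, eq_div_of_mul_eq (mul_ne_zero hz0 (Real.exp_ne_zero _)) hprod,
    Finset.sum_div, Finset.mul_sum]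
  refine Finset.sum_congr rfl fun i _ => ?_
  rw [Real.exp_sub]
  field_simp
end
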